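/- There are no integers α, β, γ satisfying simultaneously: 3α + 3β + 7γ ≤ 2, β + 4γ ≥ 1, α + γ ≥ 1, 4α + β ≥ 1, and αβ + 4αγ + βγ = 0. -/

import Mathlib

theorem stmt2 :
    ¬ ∃ α β γ : ℤ,
      3 * α + 3 * β + 7 * γ ≤ 2 ∧ 1 ≤ β + 4 * γ ∧ 1 ≤ α + γ ∧
        1 ≤ 4 * α + β ∧ α * β + 4 * α * γ + β * γ = 0 := by
  rintro ⟨α, β, γ, h1, hx, hy, hz, h0⟩
  obtain ⟨x, ex⟩ : ∃ x, x = β + 4 * γ := ⟨_, rfl⟩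
  obtain ⟨y, ey⟩ : ∃ y, y = α + γ := ⟨_, rfl⟩
  obtain ⟨z, ez⟩ : ∃ z, z = 4 * α + β := ⟨_, rfl⟩
  have hq : (4 * y - x - z) ^ 2 = 4 * (x * z) := by
    subst ex ey ez
    linear_combination (-16) * h0
  have hH : 2 * x - y + z ≤ 2 := by omega
  have hx' : 1 ≤ x := by omega
  have hz' : 1 ≤ z := by omega
  have hle : (4 * y - x - z) ^ 2 ≤ (x + z) ^ 2 := by nlinarith [sq_nonneg (x - z)]
  have h2 : 4 * y - x - z ≤ x + z := abs_le_of_sq_le_sq' hle (by omega) |>.2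
  have h3 : x = 1 := by omega
  have h4 : z = 1 := by omega
  omega
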